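/- arXiv:1602.02191 — 2 statements merged into one kernel-verified Lean document; each statement's English description precedes it below -/
import Mathlib

section
/- Let h : X → ℝ be convex and λ-Lipschitz with ∫_X h dρ = ∫_X f_c dρ, and suppose h ≠ f_c, i.e., h(x_0) ≠ f_c(x_0) for some x_0 ∈ X. Then ∫_X |h(x) − f(x)| dρ(x) > ∫_X (f(x) − f_c(x)) dρ(x) = ∫_X |f_c(x) − f(x)| dρ(x). Consequently, f_c is the unique minimizer of g ↦ ∫_X |g − f| dρ over all convex λ-Lipschitz functions g : X → ℝ satisfying ∫_X g dρ = ∫_X f_c dρ. -/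
open Set Metric MeasureTheory

/-- An almost everywhere inequality between continuous functions on `X` holds everywhere on `X`
if every ball centred in `X` meets `X` in a set of positive measure. -/
theorem le_of_ae_restrict_le_of_continuousOn {E : Type*} [PseudoMetricSpace E]
    [MeasurableSpace E] {μ : Measure E} {X : Set E}
    (hpos : ∀ x ∈ X, ∀ r > (0 : ℝ), 0 < μ (X ∩ ball x r)) {u v : E → ℝ}
    (hu : ContinuousOn u X) (hv : ContinuousOn v X)
    (hle : ∀ᵐ x ∂μ.restrict X, u x ≤ v x) : ∀ x ∈ X, u x ≤ v x := by
  intro x hx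
  by_contra! hlt
  have hev : ∀ᶠ y in nhdsWithin x X, v y < u y :=
    (hv x hx).eventually_lt (hu x hx) hlt
  obtain ⟨r, hr, hsub⟩ := Metric.mem_nhdsWithin_iff.1 hev
  refine (hpos x hx r hr).ne' (measure_mono_null ?_ (ae_iff.1 (ae_imp_of_ae_restrict hle)))
  rintro y ⟨hyX, hyr⟩ hy
  exact (hsub ⟨hyr, hyX⟩).not_ge (hy hyX)

/-- A pointwise inequality on a set, measurable or not, holds almost everywhere for the
restricted measure as soon as both sides are almost everywhere measurable. -/
theorem ae_restrict_le_of_forall_mem {E : Type*} [MeasurableSpace E] {μ : Measure E} {X : Set E}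
    {u v : E → ℝ} (hu : IntegrableOn u X μ) (hv : IntegrableOn v X μ)
    (hle : ∀ x ∈ X, u x ≤ v x) : ∀ᵐ x ∂μ.restrict X, u x ≤ v x :=
  (ae_restrict_iff₀ (nullMeasurableSet_le hu.aemeasurable hv.aemeasurable)).2
    (Filter.Eventually.of_forall hle)

/-- Continuous functions with equal integrals over `X`, one of which dominates the other on `X`,
agree on `X` if every ball centred in `X` meets `X` in a set of positive measure. -/
theorem eqOn_of_le_of_setIntegral_eq {E : Type*} [PseudoMetricSpace E]
    [MeasurableSpace E] {μ : Measure E} {X : Set E}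
    (hpos : ∀ x ∈ X, ∀ r > (0 : ℝ), 0 < μ (X ∩ ball x r)) {u v : E → ℝ}
    (hu : ContinuousOn u X) (hv : ContinuousOn v X)
    (hui : IntegrableOn u X μ) (hvi : IntegrableOn v X μ)
    (hle : ∀ x ∈ X, u x ≤ v x) (heq : ∫ x in X, u x ∂μ = ∫ x in X, v x ∂μ) :
    EqOn u v X := by
  have hae := (integral_eq_iff_of_ae_le hui hvi (ae_restrict_le_of_forall_mem hui hvi hle)).1 heq
  exact fun x hx => (hle x hx).antisymm
    (le_of_ae_restrict_le_of_continuousOn hpos hv hu hae.symm.le x hx)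

/-- The convex envelope is the unique minimizer of the expected absolute loss among
convex Lipschitz functions with the same mean as the envelope (Lemma 1 of the paper). -/
theorem envelope_unique_minimizer_of_expected_loss {n : ℕ}
    (X : Set (EuclideanSpace ℝ (Fin n)))
    (hXne : X.Nonempty) (hXbdd : Bornology.IsBounded X) (hXconv : Convex ℝ X)
    (lam : NNReal) (hlam : 0 < lam)
    (f fc : EuclideanSpace ℝ (Fin n) → ℝ)
    (hf_lip : LipschitzOnWith lam f X)
    (hfc_conv : ConvexOn ℝ X fc)
    (hfc_le : ∀ x ∈ X, fc x ≤ f x)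
    (hfc_max : ∀ g : EuclideanSpace ℝ (Fin n) → ℝ, ConvexOn ℝ X g →
      (∀ x ∈ X, g x ≤ f x) → ∀ x ∈ X, g x ≤ fc x)
    (hfc_lip : LipschitzOnWith lam fc X)
    (ρ : Measure (EuclideanSpace ℝ (Fin n))) [IsProbabilityMeasure ρ]
    (hρX : ρ X = 1)
    (hρ_pos : ∀ x ∈ X, ∀ r > (0 : ℝ), 0 < ρ (X ∩ ball x r))
    (hf_int : IntegrableOn f X ρ) (hfc_int : IntegrableOn fc X ρ)
    (h : EuclideanSpace ℝ (Fin n) → ℝ)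
    (hh_conv : ConvexOn ℝ X h) (hh_lip : LipschitzOnWith lam h X)
    (hh_int : IntegrableOn h X ρ)
    (hmean : ∫ x in X, h x ∂ρ = ∫ x in X, fc x ∂ρ)
    (x0 : EuclideanSpace ℝ (Fin n)) (hx0 : x0 ∈ X) (hne : h x0 ≠ fc x0) :
    ((∫ x in X, |h x - f x| ∂ρ) > ∫ x in X, (f x - fc x) ∂ρ) ∧
    ((∫ x in X, (f x - fc x) ∂ρ) = ∫ x in X, |fc x - f x| ∂ρ) ∧
    (∀ g : EuclideanSpace ℝ (Fin n) → ℝ, ConvexOn ℝ X g → LipschitzOnWith lam g X →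
      IntegrableOn g X ρ → (∫ x in X, g x ∂ρ) = ∫ x in X, fc x ∂ρ →
      (∃ x ∈ X, g x ≠ fc x) →
      (∫ x in X, |fc x - f x| ∂ρ) < ∫ x in X, |g x - f x| ∂ρ) := by
  have key : ∀ g : EuclideanSpace ℝ (Fin n) → ℝ, ConvexOn ℝ X g → LipschitzOnWith lam g X →
      IntegrableOn g X ρ → (∫ x in X, g x ∂ρ) = ∫ x in X, fc x ∂ρ →
      (∃ x ∈ X, g x ≠ fc x) →
      (∫ x in X, (f x - fc x) ∂ρ) < ∫ x in X, |g x - f x| ∂ρ := by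
    rintro g hg_conv hg_lip hg_int hg_mean ⟨x, hx, hgx⟩
    have hfg : ∫ x in X, (f x - fc x) ∂ρ = ∫ x in X, (f x - g x) ∂ρ := by
      rw [integral_sub hf_int hfc_int, integral_sub hf_int hg_int, hg_mean]
    have hle : ∀ x, f x - g x ≤ |g x - f x| := fun x => by
      rw [abs_sub_comm]; exact le_abs_self _
    have habs : IntegrableOn (fun x => |g x - f x|) X ρ := (hg_int.sub hf_int).abs
    rw [hfg]
    refine lt_of_le_of_ne (integral_mono (hf_int.sub hg_int) habs hle) fun heq => hgx ?_
    have hae := (integral_eq_iff_of_ae_le (hf_int.sub hg_int) habs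
      (Filter.Eventually.of_forall hle)).1 heq
    have hgf : ∀ᵐ x ∂ρ.restrict X, g x ≤ f x := by
      filter_upwards [hae] with y hy
      have hy' : f y - g y = |g y - f y| := hy
      linarith [abs_nonneg (g y - f y)]
    have hg_le_f := le_of_ae_restrict_le_of_continuousOn hρ_pos hg_lip.continuousOn
      hf_lip.continuousOn hgf
    exact eqOn_of_le_of_setIntegral_eq hρ_pos hg_lip.continuousOn hfc_lip.continuousOn
      hg_int hfc_int (hfc_max g hg_conv hg_le_f) hg_mean hx
  have henv : (∫ x in X, (f x - fc x) ∂ρ) = ∫ x in X, |fc x - f x| ∂ρ := by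
    refine integral_congr_ae ?_
    filter_upwards [ae_restrict_le_of_forall_mem hfc_int hf_int hfc_le] with x hx
    rw [abs_sub_comm, abs_of_nonneg (sub_nonneg.2 hx)]
  exact ⟨key h hh_conv hh_lip hh_int hmean ⟨x0, hx0, hne⟩, henv, henv ▸ key⟩
end

section
/- Let f_c : X → ℝ be measurable with f_c(x) ≤ f(x) for all x ∈ X, and let h : X → ℝ be λ-Lipschitz with ∫_X h dρ = ∫_X f_c dρ. If h(x_o) > f(x_o) for some x_o ∈ X, then ∫_X |h(x) − f(x)| dρ(x) > ∫_X (f(x) − f_c(x)) dρ(x). -/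
open Set Metric MeasureTheory

/-- If a Lipschitz function `h` with the same mean as an underestimate `fc` of `f`
overestimates `f` somewhere, then its expected absolute loss strictly exceeds
the expected gap between `f` and `fc`. -/
theorem loss_gt_of_overestimate {n : ℕ}
    (X : Set (EuclideanSpace ℝ (Fin n)))
    (hXne : X.Nonempty) (hXbdd : Bornology.IsBounded X) (hXconv : Convex ℝ X)
    (lam : NNReal) (hlam : 0 < lam)
    (f : EuclideanSpace ℝ (Fin n) → ℝ)
    (hf_lip : LipschitzOnWith lam f X)
    (ρ : Measure (EuclideanSpace ℝ (Fin n))) [IsProbabilityMeasure ρ]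
    (hρX : ρ X = 1)
    (hρ_pos : ∀ x ∈ X, ∀ r > (0 : ℝ), 0 < ρ (X ∩ ball x r))
    (fc : EuclideanSpace ℝ (Fin n) → ℝ) (hfc_meas : Measurable fc)
    (hfc_le : ∀ x ∈ X, fc x ≤ f x)
    (h : EuclideanSpace ℝ (Fin n) → ℝ) (hh_lip : LipschitzOnWith lam h X)
    (hf_int : IntegrableOn f X ρ) (hfc_int : IntegrableOn fc X ρ)
    (hh_int : IntegrableOn h X ρ)
    (habs_int : IntegrableOn (fun x => |h x - f x|) X ρ)
    (hmean : ∫ x in X, h x ∂ρ = ∫ x in X, fc x ∂ρ)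
    (xo : EuclideanSpace ℝ (Fin n)) (hxo : xo ∈ X) (hgt : h xo > f xo) :
    (∫ x in X, |h x - f x| ∂ρ) > ∫ x in X, (f x - fc x) ∂ρ := by
  have hgap : ∫ x in X, (f x - fc x) ∂ρ = ∫ x in X, (f x - h x) ∂ρ := by
    rw [integral_sub hf_int hfc_int, integral_sub hf_int hh_int, hmean]
  have hfh_int : IntegrableOn (fun x => f x - h x) X ρ := hf_int.sub hh_int
  have hexcess_int : IntegrableOn (fun x => |h x - f x| - (f x - h x)) X ρ :=
    habs_int.sub hfh_int
  rw [gt_iff_lt, hgap, ← sub_pos, ← integral_sub habs_int hfh_int,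
    integral_pos_iff_support_of_nonneg
      (fun x => sub_nonneg.2 (abs_sub_comm (f x) (h x) ▸ le_abs_self (f x - h x))) hexcess_int]
  have hcont : ContinuousOn (fun x => h x - f x) X :=
    hh_lip.continuousOn.sub hf_lip.continuousOn
  obtain ⟨r, hr, hball⟩ := Metric.mem_nhdsWithin_iff.1
    ((hcont xo hxo).eventually (lt_mem_nhds (sub_pos.2 hgt)))
  refine (hρ_pos xo hxo r hr).trans_le (le_trans ?_ (Measure.le_restrict_apply X _))
  refine measure_mono fun x hx => ⟨?_, hx.1⟩
  have hpos : 0 < h x - f x := hball ⟨hx.2, hx.1⟩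
  rw [Function.mem_support, abs_of_pos hpos]
  linarith
end
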